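/- Let k ≥ 2, set m = ⌈log₂(k+2)⌉, and suppose 2^{m-1} − 1 ≤ k ≤ 2^m − C(m,⌊m/2⌋) − 1. Then for every n ≥ 1, if F is a D_k-free family of subsets of [n] with |F| = Σ(n,m), then F equals B(n,m), i.e. F is either the family of all subsets A with ⌊(n-m+1)/2⌋ ≤ |A| ≤ ⌊(n+m-1)/2⌋ or the family of all subsets A with ⌈(n-m+1)/2⌉ ≤ |A| ≤ ⌈(n+m-1)/2⌉. -/

import Mathlib

open Finset

/-- `F` is `D_k`-free: there are no pairwise distinct `A, B_1, …, B_k, C ∈ F`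
with `A ⊆ B_i ⊆ C` for all `i`. -/
def DkFree (n k : ℕ) (F : Finset (Finset (Fin n))) : Prop :=
  ¬ ∃ (A C : Finset (Fin n)) (B : Fin k → Finset (Fin n)),
      A ∈ F ∧ C ∈ F ∧ (∀ i, B i ∈ F) ∧
      Function.Injective B ∧ (∀ i, B i ≠ A ∧ B i ≠ C) ∧ A ≠ C ∧
      (∀ i, A ⊆ B i ∧ B i ⊆ C)

/-- `Σ(n,m)`: the sum of the `m` largest binomial coefficients `C(n,i)`,
i.e. `Σ_{i=0}^{m-1} C(n, ⌊(n-m+1)/2⌋ + i)`. -/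
def middleBinomSum (n m : ℕ) : ℕ :=
  ∑ i ∈ Finset.range m, n.choose ((n - m + 1) / 2 + i)

/-- `B(n,m)` (lower variant): all subsets `A` of `[n]` with
`⌊(n-m+1)/2⌋ ≤ |A| ≤ ⌊(n+m-1)/2⌋`. -/
def Blow (n m : ℕ) : Finset (Finset (Fin n)) :=
  Finset.univ.filter (fun A => (n - m + 1) / 2 ≤ A.card ∧ A.card ≤ (n + m - 1) / 2)

/-- `B(n,m)` (upper variant): all subsets `A` of `[n]` with
`⌈(n-m+1)/2⌉ ≤ |A| ≤ ⌈(n+m-1)/2⌉`. -/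
def Bhigh (n m : ℕ) : Finset (Finset (Fin n)) :=
  Finset.univ.filter (fun A => (n - m + 2) / 2 ≤ A.card ∧ A.card ≤ (n + m) / 2)


/-- probability that a random maximal chain from `∅` to `X` has no member of `F` strictly below `X` -/
def ppF {n : ℕ} (F : Finset (Finset (Fin n))) : ℕ → Finset (Fin n) → ℚ
  | 0, _ => 1
  | (k+1), X => (∑ x ∈ X, if X.erase x ∈ F then 0 else ppF F k (X.erase x)) / ((k : ℚ) + 1)

theorem ppF_nonneg {n : ℕ} (F : Finset (Finset (Fin n))) (k : ℕ) (X : Finset (Fin n)) :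
    0 ≤ ppF F k X := by
  induction k generalizing X with
  | zero => simp [ppF]
  | succ k ih =>
    rw [ppF]
    apply div_nonneg _ (by positivity)
    apply Finset.sum_nonneg
    intro x _
    split_ifs
    · exact le_rfl
    · exact ih _

theorem ppF_strict {n : ℕ} (F : Finset (Finset (Fin n))) (k : ℕ) (X : Finset (Fin n))
    (hX : X.card = k) :
    ∑ A ∈ F with A ⊂ X, ppF F A.card A / ((k.choose A.card : ℕ) : ℚ) = 1 - ppF F k X := by
  induction k generalizing X with
  | zero =>
    have : X = ∅ := by simpa using hX
    subst this
    simp [ppF]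
  | succ k ih =>
    have h1 : ∀ x ∈ X, (if X.erase x ∈ F then (0:ℚ) else ppF F k (X.erase x)) =
        1 - ∑ A ∈ F with A ⊆ X.erase x, ppF F A.card A / ((k.choose A.card : ℕ) : ℚ) := by
      intro x hx
      have hc : (X.erase x).card = k := by rw [card_erase_of_mem hx, hX]; rfl
      have := ih _ hc
      split_ifs with h
      · have e : (F.filter (fun A => A ⊆ X.erase x)) =
            insert (X.erase x) (F.filter (fun A => A ⊂ X.erase x)) := by
          ext A
          simp only [mem_filter, mem_insert]
          constructor
          · rintro ⟨a, b⟩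
            rcases b.eq_or_ssubset with h | h
            · exact Or.inl h
            · exact Or.inr ⟨a, h⟩
          · rintro (rfl | ⟨a, b⟩)
            · exact ⟨h, subset_rfl⟩
            · exact ⟨a, b.subset⟩
        rw [e, sum_insert (by simp), this, hc]
        simp
      · have e : (F.filter (fun A => A ⊆ X.erase x)) = (F.filter (fun A => A ⊂ X.erase x)) := by
          ext A
          simp only [mem_filter]
          constructor
          · rintro ⟨a, b⟩
            rcases b.eq_or_ssubset with h' | h'
            · exact absurd (h' ▸ a) h
            · exact ⟨a, h'⟩
          · rintro ⟨a, b⟩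
            exact ⟨a, b.subset⟩
        rw [e, this]
        ring
    rw [ppF, sum_congr rfl h1, sum_sub_distrib]
    simp only [sum_const, hX, nsmul_eq_mul, mul_one, sum_filter]
    rw [sum_comm]
    have hk : ((k : ℚ) + 1) ≠ 0 := by positivity
    rw [sub_div]
    push_cast
    rw [div_self hk, sub_sub_cancel, sum_div]
    apply sum_congr rfl
    intro A hA
    by_cases hAX : A ⊂ X
    · rw [if_pos hAX]
      have e2 : ∀ x ∈ X, (if A ⊆ X.erase x then ppF F A.card A / ((k.choose A.card : ℕ) : ℚ) else 0)
          = if x ∈ X \ A then ppF F A.card A / ((k.choose A.card : ℕ) : ℚ) else 0 := by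
        intro x hx
        have : A ⊆ X.erase x ↔ x ∈ X \ A := by
          rw [subset_erase, mem_sdiff]
          exact ⟨fun h => ⟨hx, h.2⟩, fun h => ⟨hAX.subset, h.2⟩⟩
        simp only [this]
      rw [sum_congr rfl e2, ← sum_filter]
      have e3 : X.filter (fun x => x ∈ X \ A) = X \ A := by
        ext x; simp
      rw [e3, sum_const, card_sdiff_of_subset hAX.subset, hX, nsmul_eq_mul]
      have hlt : A.card < k + 1 := hX ▸ card_lt_card hAX
      have c1 : ((k.choose A.card : ℕ) : ℚ) ≠ 0 := by
        have := Nat.choose_pos (n := k) (k := A.card) (by omega)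
        positivity
      have c2 : (((k+1).choose A.card : ℕ) : ℚ) ≠ 0 := by
        have := Nat.choose_pos (n := k+1) (k := A.card) (by omega)
        positivity
      have key := Nat.choose_mul_succ_eq k A.card
      have key' : ((k.choose A.card : ℕ) : ℚ) * ((k:ℚ)+1) =
        (((k+1).choose A.card : ℕ) : ℚ) * ((k + 1 - A.card : ℕ) : ℚ) := by exact_mod_cast key
      field_simp
      linear_combination (ppF F A.card A) * key'
    · rw [if_neg hAX, sum_eq_zero, zero_div]
      intro x hx
      rw [if_neg]
      intro h
      exact hAX (h.trans_ssubset (erase_ssubset hx))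

theorem ppF_mem {n : ℕ} (F : Finset (Finset (Fin n))) (X : Finset (Fin n)) (hX : X ∈ F) :
    ∑ A ∈ F with A ⊆ X, ppF F A.card A / ((X.card.choose A.card : ℕ) : ℚ) = 1 := by
  have e : (F.filter (fun A => A ⊆ X)) = insert X (F.filter (fun A => A ⊂ X)) := by
    ext A
    simp only [mem_filter, mem_insert]
    constructor
    · rintro ⟨a, b⟩
      rcases b.eq_or_ssubset with h | h
      · exact Or.inl h
      · exact Or.inr ⟨a, h⟩
    · rintro (rfl | ⟨a, b⟩)
      · exact ⟨hX, subset_rfl⟩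
      · exact ⟨a, b.subset⟩
  rw [e, sum_insert (by simp), ppF_strict F X.card X rfl]
  simp

theorem ppF_le {n : ℕ} (F : Finset (Finset (Fin n))) (X : Finset (Fin n)) :
    ∑ A ∈ F with A ⊆ X, ppF F A.card A / ((X.card.choose A.card : ℕ) : ℚ) ≤ 1 := by
  by_cases hX : X ∈ F
  · exact (ppF_mem F X hX).le
  have e : (F.filter (fun A => A ⊆ X)) = (F.filter (fun A => A ⊂ X)) := by
    ext A
    simp only [mem_filter]
    constructor
    · rintro ⟨a, b⟩
      rcases b.eq_or_ssubset with h | h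
      · exact absurd (h ▸ a) hX
      · exact ⟨a, h⟩
    · rintro ⟨a, b⟩
      exact ⟨a, b.subset⟩
  rw [e, ppF_strict F X.card X rfl]
  linarith [ppF_nonneg F X.card X]

/-- weight identity -/
theorem weight_id (n a x b : ℕ) (h1 : a ≤ x) (h2 : x ≤ b) (h3 : b ≤ n) :
    n.choose x * x.choose a * (n - x).choose (n - b) =
      n.choose (n - b) * b.choose a * (b - a).choose (x - a) := by
  have e1 := Nat.choose_mul (n := n) (k := b) (s := x) h2
  have e2 := Nat.choose_mul (n := b) (k := x) (s := a) h1
  have e3 : (n - x).choose (n - b) = (n - x).choose (b - x) := by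
    rw [← Nat.choose_symm (show b - x ≤ n - x by omega)]
    congr 1; omega
  rw [e3, Nat.choose_symm h3]
  calc _ = (n.choose x * (n-x).choose (b-x)) * x.choose a := by ring
    _ = n.choose b * (b.choose x * x.choose a) := by rw [← e1]; ring
    _ = _ := by rw [e2]; ring

theorem lubell_le {n : ℕ} (F : Finset (Finset (Fin n))) (M : ℚ) (hM : 0 ≤ M)
    (h : ∀ A ∈ F, ∀ B ∈ F, A ⊆ B →
      ∑ X ∈ F with A ⊆ X ∧ X ⊆ B, (1:ℚ) / (((B.card - A.card).choose (X.card - A.card) : ℕ) : ℚ) ≤ M) :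
    ∑ X ∈ F, (1:ℚ) / ((n.choose X.card : ℕ) : ℚ) ≤ M := by
  classical
  set p : Finset (Fin n) → ℚ := fun A => ppF F A.card A with hpdef
  set q : Finset (Fin n) → ℚ := fun B => ppF (F.image compl) Bᶜ.card Bᶜ with hqdef
  have hp0 : ∀ A, 0 ≤ p A := fun A => ppF_nonneg _ _ _
  have hq0 : ∀ A, 0 ≤ q A := fun A => ppF_nonneg _ _ _
  have hp : ∀ X ∈ F, ∑ A ∈ F, (if A ⊆ X then p A / ((X.card.choose A.card : ℕ) : ℚ) else 0) = 1 := by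
    intro X hX
    rw [← sum_filter]
    exact ppF_mem F X hX
  have hqgen : ∀ X : Finset (Fin n),
      ∑ A ∈ F.image compl with A ⊆ Xᶜ, ppF (F.image compl) A.card A / ((Xᶜ.card.choose A.card : ℕ) : ℚ)
      = ∑ B ∈ F, (if X ⊆ B then q B / (((n - X.card).choose (n - B.card) : ℕ) : ℚ) else 0) := by
    intro X
    rw [sum_filter, sum_image (fun a _ b _ hab => compl_injective hab)]
    apply sum_congr rfl
    intro B _
    simp only [compl_subset_compl, hqdef, card_compl, Fintype.card_fin]
  have hq : ∀ X ∈ F, ∑ B ∈ F, (if X ⊆ B then q B / (((n - X.card).choose (n - B.card) : ℕ) : ℚ) else 0) = 1 := by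
    intro X hX
    rw [← hqgen]
    exact ppF_mem _ _ (mem_image_of_mem _ hX)
  have hq1 : ∑ B ∈ F, q B / ((n.choose (n - B.card) : ℕ) : ℚ) ≤ 1 := by
    have := ppF_le (F.image compl) (∅ᶜ)
    rw [hqgen] at this
    simpa using this
  calc ∑ X ∈ F, (1:ℚ) / ((n.choose X.card : ℕ) : ℚ)
      = ∑ X ∈ F, ∑ B ∈ F, ∑ A ∈ F, (1:ℚ) / ((n.choose X.card : ℕ) : ℚ) *
          (if A ⊆ X then p A / ((X.card.choose A.card : ℕ) : ℚ) else 0) *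
          (if X ⊆ B then q B / (((n - X.card).choose (n - B.card) : ℕ) : ℚ) else 0) := by
        apply sum_congr rfl
        intro X hX
        simp_rw [← sum_mul, ← mul_sum]
        rw [hp X hX, hq X hX]
        ring
    _ = ∑ B ∈ F, ∑ A ∈ F, ∑ X ∈ F, (1:ℚ) / ((n.choose X.card : ℕ) : ℚ) *
          (if A ⊆ X then p A / ((X.card.choose A.card : ℕ) : ℚ) else 0) *
          (if X ⊆ B then q B / (((n - X.card).choose (n - B.card) : ℕ) : ℚ) else 0) := by
        rw [sum_comm]
        apply sum_congr rfl
        intro B _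
        rw [sum_comm]
    _ ≤ ∑ B ∈ F, ∑ A ∈ F, (q B / ((n.choose (n - B.card) : ℕ) : ℚ)) *
          (if A ⊆ B then p A / ((B.card.choose A.card : ℕ) : ℚ) else 0) * M := by
        apply sum_le_sum
        intro B hB
        apply sum_le_sum
        intro A hA
        by_cases hAB : A ⊆ B
        · rw [if_pos hAB]
          have e : ∀ X ∈ F, (1:ℚ) / ((n.choose X.card : ℕ) : ℚ) *
            (if A ⊆ X then p A / ((X.card.choose A.card : ℕ) : ℚ) else 0) *
            (if X ⊆ B then q B / (((n - X.card).choose (n - B.card) : ℕ) : ℚ) else 0) =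
            (q B / ((n.choose (n - B.card) : ℕ) : ℚ)) * (p A / ((B.card.choose A.card : ℕ) : ℚ)) *
            (if A ⊆ X ∧ X ⊆ B then (1:ℚ) / (((B.card - A.card).choose (X.card - A.card) : ℕ) : ℚ) else 0) := by
            intro X _
            by_cases h1 : A ⊆ X
            · by_cases h2 : X ⊆ B
              · rw [if_pos h1, if_pos h2, if_pos ⟨h1, h2⟩]
                have hBn : B.card ≤ n := by simpa using card_le_univ B
                have := weight_id n A.card X.card B.card (card_le_card h1) (card_le_card h2) hBn
                have this' : ((n.choose X.card : ℕ) : ℚ) * ((X.card.choose A.card : ℕ) : ℚ) *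
                  (((n - X.card).choose (n - B.card) : ℕ) : ℚ) =
                  ((n.choose (n - B.card) : ℕ) : ℚ) * ((B.card.choose A.card : ℕ) : ℚ) *
                  (((B.card - A.card).choose (X.card - A.card) : ℕ) : ℚ) := by exact_mod_cast this
                rw [div_mul_div_comm, div_mul_div_comm, div_mul_div_comm, div_mul_div_comm, this']
                ring
              · simp [h2]
            · simp [h1]
          rw [sum_congr rfl e, ← mul_sum, ← sum_filter]
          apply mul_le_mul_of_nonneg_left (h A hA B hB hAB)
          have := hp0 A
          have := hq0 B
          positivity
        · rw [if_neg hAB, sum_eq_zero]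
          · simp
          intro X _
          by_cases h1 : A ⊆ X
          · have h2 : ¬ X ⊆ B := fun h2 => hAB (h1.trans h2)
            simp [h2]
          · simp [h1]
    _ = (∑ B ∈ F, q B / ((n.choose (n - B.card) : ℕ) : ℚ)) * M := by
        rw [sum_mul]
        apply sum_congr rfl
        intro B hB
        rw [← sum_mul, ← mul_sum, hp B hB, mul_one]
    _ ≤ M := by nlinarith

theorem num_lemma (N : ℕ) (c x : ℕ → ℚ) (T : ℚ) (hT : 0 < T) (S : Finset ℕ)
    (hS : S ⊆ range N)
    (hc : ∀ j ∈ range N, 0 < c j) (hx : ∀ j ∈ range N, 0 ≤ x j ∧ x j ≤ c j)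
    (h1 : ∀ j ∈ S, c j ≤ T) (h2 : ∀ j ∈ range N, j ∉ S → T ≤ c j)
    (hsum : ∑ j ∈ range N, x j ≤ ∑ j ∈ S, c j) :
    ∑ j ∈ range N, x j / c j ≤ S.card := by
  have key : ∀ j ∈ range N, x j / c j ≤ (if j ∈ S then 1 - c j / T else 0) + x j / T := by
    intro j hj
    have hcj := hc j hj
    obtain ⟨hx0, hx1⟩ := hx j hj
    split_ifs with h
    · have := h1 j h
      have e : 1 - c j / T + x j / T - x j / c j = (c j - x j) * (T - c j) / (c j * T) := by
        field_simp; ring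
      have : 0 ≤ (c j - x j) * (T - c j) / (c j * T) := by
        apply div_nonneg (mul_nonneg _ _) (by positivity) <;> linarith
      linarith
    · rw [zero_add]
      exact div_le_div_of_nonneg_left hx0 hT (h2 j hj h)
  have := sum_le_sum key
  rw [sum_add_distrib, ← sum_filter, filter_mem_eq_inter, inter_eq_right.mpr hS, sum_sub_distrib,
    ← sum_div, ← sum_div] at this
  have h3 : (∑ j ∈ range N, x j) / T ≤ (∑ j ∈ S, c j) / T := by gcongr
  simp only [sum_const, nsmul_eq_mul, mul_one] at this
  linarith

theorem cmono (d i j : ℕ) (h : i ≤ j) (hj : j ≤ d / 2) : d.choose i ≤ d.choose j := by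
  induction j, h using Nat.le_induction with
  | base => exact le_rfl
  | succ j _ ih =>
    exact (ih (by omega)).trans (Nat.choose_le_succ_of_lt_half_left (by omega))

theorem cmono_strict (d i j : ℕ) (h : i < j) (hj : j ≤ d / 2) : d.choose i < d.choose j := by
  have h1 : d.choose i < d.choose (i+1) := by
    have e := Nat.choose_succ_right_eq d i
    have hp := Nat.choose_pos (n := d) (k := i) (by omega)
    by_contra hc
    push Not at hc
    have : i + 1 < d - i ∨ i + 1 = d - i := by omega
    nlinarith [Nat.mul_le_mul hc (le_refl (i+1)), show i + 1 < d - i by omega]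
  exact h1.trans_le (cmono d (i+1) j h hj)

theorem cmono2 (d c j : ℕ) (h1 : c ≤ j) (h2 : j + c ≤ d) : d.choose c ≤ d.choose j := by
  by_cases h : j ≤ d / 2
  · exact cmono d c j h1 h
  · rw [← Nat.choose_symm (show j ≤ d by omega)]
    exact cmono d c (d - j) (by omega) (by omega)

theorem cmono2_strict (d c j : ℕ) (h1 : c < j) (h2 : j + c < d) : d.choose c < d.choose j := by
  by_cases h : j ≤ d / 2
  · exact cmono_strict d c j h1 h
  · rw [← Nat.choose_symm (show j ≤ d by omega)]
    exact cmono_strict d c (d - j) (by omega) (by omega)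

/-- outer levels -/
def Slev (m d : ℕ) : Finset ℕ := range ((m+1)/2) ∪ (range (m/2)).image (fun j => d - j)

theorem Slev_mem (m d j : ℕ) (hm : m ≤ d) (hj : j ≤ d) :
    j ∈ Slev m d ↔ j < (m+1)/2 ∨ d < j + m/2 := by
  simp only [Slev, mem_union, mem_range, mem_image]
  constructor
  · rintro (h | ⟨a, h, rfl⟩)
    · exact Or.inl h
    · right; omega
  · rintro (h | h)
    · exact Or.inl h
    · exact Or.inr ⟨d - j, by omega, by omega⟩

theorem Slev_sub (m d : ℕ) (hm : m ≤ d) : Slev m d ⊆ range (d+1) := by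
  intro j
  simp only [Slev, mem_union, mem_range, mem_image]
  rintro (h | ⟨a, h, rfl⟩) <;> omega

theorem Slev_sum {M : Type*} [AddCommMonoid M] (m d : ℕ) (hm : m ≤ d) (f : ℕ → M) :
    ∑ j ∈ Slev m d, f j = ∑ j ∈ range ((m+1)/2), f j + ∑ j ∈ range (m/2), f (d - j) := by
  rw [Slev, sum_union, sum_image]
  · intro a ha b hb h
    simp only [coe_range, Set.mem_Iio] at ha hb
    simp only at h
    omega
  · rw [disjoint_left]
    intro j
    simp only [mem_range, mem_image]
    rintro h ⟨a, h2, rfl⟩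
    omega

theorem Slev_card (m d : ℕ) (hm : m ≤ d) : (Slev m d).card = m := by
  rw [card_eq_sum_ones, Slev_sum m d hm]
  simp
  omega

theorem Slev_choose (m d : ℕ) (hm : m ≤ d) :
    2 ^ m - m.choose (m/2) ≤ ∑ j ∈ Slev m d, d.choose j := by
  have h1 : 2 ^ m - m.choose (m/2) = ∑ j ∈ Slev m m, m.choose j := by
    have hins : range (m+1) = insert ((m+1)/2) (Slev m m) := by
      ext j
      rw [mem_insert]
      by_cases hj : j ≤ m
      · rw [Slev_mem m m j le_rfl hj, mem_range]; omega
      · constructor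
        · intro h; rw [mem_range] at h; omega
        · rintro (h | h)
          · omega
          · exact Slev_sub m m le_rfl h
    have hn : (m+1)/2 ∉ Slev m m := by
      rw [Slev_mem m m _ le_rfl (by omega)]; omega
    have := Nat.sum_range_choose m
    rw [hins, sum_insert hn] at this
    have e : m.choose ((m+1)/2) = m.choose (m/2) := by
      rw [← Nat.choose_symm (show m/2 ≤ m by omega)]
      congr 1; omega
    rw [e] at this
    omega
  rw [h1, Slev_sum m m le_rfl, Slev_sum m d hm]
  apply add_le_add
  · exact sum_le_sum fun j _ => Nat.choose_le_choose j hm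
  · apply sum_le_sum
    intro j hj
    rw [mem_range] at hj
    rw [Nat.choose_symm (by omega), Nat.choose_symm (by omega)]
    exact Nat.choose_le_choose j hm

theorem interval_card {n k : ℕ} (F : Finset (Finset (Fin n))) (hF : DkFree n k F)
    (A B : Finset (Fin n)) (hA : A ∈ F) (hB : B ∈ F) (hne : A ≠ B) :
    (F.filter (fun X => A ⊆ X ∧ X ⊆ B)).card ≤ k + 1 := by
  by_contra hc
  push Not at hc
  set G := F.filter (fun X => A ⊆ X ∧ X ⊆ B) with hG
  have h1 : k ≤ ((G.erase A).erase B).card := by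
    have := pred_card_le_card_erase (s := G) (a := A)
    have := pred_card_le_card_erase (s := G.erase A) (a := B)
    omega
  obtain ⟨H, hH, hHk⟩ := exists_subset_card_eq h1
  have e := H.equivFinOfCardEq hHk
  have hmem : ∀ i, (e.symm i : Finset (Fin n)) ∈ (G.erase A).erase B := fun i => hH (e.symm i).2
  apply hF
  refine ⟨A, B, fun i => (e.symm i : Finset (Fin n)), hA, hB, ?_, ?_, ?_, hne, ?_⟩
  · intro i
    have := hmem i
    simp only [mem_erase, hG, mem_filter] at this
    exact this.2.2.1
  · exact Subtype.val_injective.comp e.symm.injective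
  · intro i
    have := hmem i
    simp only [mem_erase, hG, mem_filter] at this
    exact ⟨this.2.1, this.1⟩
  · intro i
    have := hmem i
    simp only [mem_erase, hG, mem_filter] at this
    exact this.2.2.2

theorem interval_bound {n k m : ℕ} (F : Finset (Finset (Fin n))) (hF : DkFree n k F)
    (hm : 1 ≤ m) (hk : k + 1 ≤ 2 ^ m - m.choose (m/2))
    (A B : Finset (Fin n)) (hA : A ∈ F) (hB : B ∈ F) (hAB : A ⊆ B) :
    ∑ X ∈ F with A ⊆ X ∧ X ⊆ B, (1:ℚ) / (((B.card - A.card).choose (X.card - A.card) : ℕ) : ℚ) ≤ m := by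
  set G := F.filter (fun X => A ⊆ X ∧ X ⊆ B) with hG
  set d := B.card - A.card with hd
  have hGm : ∀ X ∈ G, A ⊆ X ∧ X ⊆ B := fun X hX => (mem_filter.mp hX).2
  have hmaps : ∀ X ∈ G, X.card - A.card ∈ range (d+1) := by
    intro X hX
    have := card_le_card (hGm X hX).2
    rw [mem_range]; omega
  set x : ℕ → ℕ := fun j => (G.filter (fun X => X.card - A.card = j)).card with hx
  have hxc : ∀ j, x j ≤ d.choose j := by
    intro j
    have : (powersetCard j (B \ A)).card = d.choose j := by
      rw [card_powersetCard, card_sdiff_of_subset hAB]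
    rw [← this]
    apply card_le_card_of_injOn (fun X => X \ A)
    · intro X hX
      simp only [coe_filter, Set.mem_ofPred_eq] at hX
      have := hGm X hX.1
      simp only [mem_coe, mem_powersetCard]
      exact ⟨sdiff_subset_sdiff this.2 subset_rfl, by rw [card_sdiff_of_subset this.1]; exact hX.2⟩
    · intro X hX Y hY h
      simp only [coe_filter, Set.mem_ofPred_eq] at hX hY
      simp only at h
      rw [← sdiff_union_of_subset (hGm X hX.1).1, ← sdiff_union_of_subset (hGm Y hY.1).1, h]
  have hsumx : ∑ j ∈ range (d+1), x j = G.card := (card_eq_sum_card_fiberwise hmaps).symm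
  have hsum : ∑ X ∈ G, (1:ℚ) / ((d.choose (X.card - A.card) : ℕ) : ℚ) =
      ∑ j ∈ range (d+1), (x j : ℚ) / ((d.choose j : ℕ) : ℚ) := by
    rw [← sum_fiberwise_of_maps_to hmaps]
    apply sum_congr rfl
    intro j _
    rw [sum_congr rfl (g := fun _ => (1:ℚ) / ((d.choose j : ℕ) : ℚ))]
    · rw [sum_const, nsmul_eq_mul, mul_one_div]
    · intro X hX
      rw [(mem_filter.mp hX).2]
  rw [hsum]
  have hpos : ∀ j ∈ range (d+1), (0:ℚ) < ((d.choose j : ℕ) : ℚ) := by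
    intro j hj
    rw [mem_range] at hj
    exact_mod_cast Nat.choose_pos (by omega)
  by_cases hdm : d < m
  · calc ∑ j ∈ range (d+1), (x j : ℚ) / ((d.choose j : ℕ) : ℚ) ≤ ∑ j ∈ range (d+1), (1:ℚ) := by
          apply sum_le_sum
          intro j hj
          rw [div_le_one (hpos j hj)]
          exact_mod_cast hxc j
      _ = ((d+1 : ℕ) : ℚ) := by simp
      _ ≤ m := by exact_mod_cast hdm
  · push Not at hdm
    have hne : A ≠ B := by
      rintro rfl
      omega
    have hGc := interval_card F hF A B hA hB hne
    have := num_lemma (d+1) (fun j => ((d.choose j : ℕ) : ℚ)) (fun j => (x j : ℚ))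
      ((d.choose ((m+1)/2 - 1) : ℕ) : ℚ) (hpos _ (by rw [mem_range]; omega))
      (Slev m d) (Slev_sub m d hdm) hpos (fun j _ => ⟨by positivity, by exact_mod_cast hxc j⟩)
      ?_ ?_ ?_
    · rwa [Slev_card m d hdm] at this
    · intro j hj
      have hj' := mem_range.mp (Slev_sub m d hdm hj)
      rw [Slev_mem m d j hdm (by omega)] at hj
      simp only [Nat.cast_le]
      rcases hj with h | h
      · exact cmono2 d _ _ (by omega) (by omega)
      · rw [← Nat.choose_symm (show j ≤ d by omega)]
        exact cmono2 d _ _ (by omega) (by omega)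
    · intro j hj' hj
      rw [mem_range] at hj'
      rw [Slev_mem m d j hdm (by omega)] at hj
      simp only [Nat.cast_le]
      exact cmono2 d _ _ (by omega) (by omega)
    · have h1 := Slev_choose m d hdm
      have h2 : ∑ j ∈ range (d+1), x j ≤ ∑ j ∈ Slev m d, d.choose j := by
        rw [hsumx]; exact hGc.trans (hk.trans h1)
      exact_mod_cast h2

theorem two_level {n l m : ℕ} (hn : n = l + m + l) (hm : 1 ≤ m)
    (P Q : Finset (Finset (Fin n))) (hP : ∀ X ∈ P, X.card = l) (hQ : ∀ X ∈ Q, X.card = l + m)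
    (hPQ : P.card + Q.card = n.choose l) (hfree : ∀ X ∈ P, ∀ Y ∈ Q, ¬ X ⊆ Y)
    (hne : P.Nonempty) : Q = ∅ := by
  classical
  set U := (powersetCard (l+m) (univ : Finset (Fin n))) with hU
  have hQU : Q ⊆ U := fun Y hY => by rw [hU, mem_powersetCard]; exact ⟨subset_univ _, hQ Y hY⟩
  have hUc : U.card = n.choose l := by
    rw [hU, card_powersetCard, card_univ, Fintype.card_fin, ← Nat.choose_symm (show l ≤ n by omega)]
    congr 1; omega
  have hUQ : (U \ Q).card = P.card := by
    rw [card_sdiff_of_subset hQU]; omega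
  set D := (l+m).choose l with hD
  have hup : ∀ X ∈ P, D ≤ ((U \ Q).filter (fun Y => X ⊆ Y)).card := by
    intro X hX
    have hc : (powersetCard m Xᶜ).card = D := by
      rw [card_powersetCard, card_compl, Fintype.card_fin, hP X hX, hD,
        ← Nat.choose_symm (show l ≤ l + m by omega)]
      congr 1 <;> omega
    rw [← hc]
    have hdj : ∀ Z ∈ powersetCard m Xᶜ, Disjoint X Z := by
      intro Z hZ
      rw [mem_powersetCard] at hZ
      exact (disjoint_compl_right (a := X)).mono_right hZ.1
    apply card_le_card_of_injOn (fun Z => X ∪ Z)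
    · intro Z hZ
      have hd := hdj Z hZ
      rw [mem_coe, mem_powersetCard] at hZ
      simp only [coe_filter, Set.mem_ofPred_eq, mem_sdiff]
      refine ⟨⟨?_, ?_⟩, subset_union_left⟩
      · rw [hU, mem_powersetCard]
        exact ⟨subset_univ _, by rw [card_union_of_disjoint hd, hP X hX, hZ.2]⟩
      · exact fun h => hfree X hX _ h subset_union_left
    · intro Z hZ W hW h
      simp only at h
      have h1 := hdj Z hZ
      have h2 := hdj W hW
      have := congrArg (fun S => S \ X) h
      simpa [union_sdiff_left, sdiff_eq_self_of_disjoint h1.symm, sdiff_eq_self_of_disjoint h2.symm] using this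
  have hsubP : ∀ Y, P.filter (fun X => X ⊆ Y) ⊆ powersetCard l Y := by
    intro Y X hX
    rw [mem_filter] at hX
    rw [mem_powersetCard]
    exact ⟨hX.2, hP X hX.1⟩
  have hdown : ∀ Y ∈ U \ Q, (P.filter (fun X => X ⊆ Y)).card ≤ D := by
    intro Y hY
    have h1 := card_le_card (hsubP Y)
    rw [mem_sdiff, hU, mem_powersetCard] at hY
    rwa [card_powersetCard, hY.1.2] at h1
  have hdc : ∑ Y ∈ U \ Q, (P.filter (fun X => X ⊆ Y)).card =
      ∑ X ∈ P, ((U \ Q).filter (fun Y => X ⊆ Y)).card := by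
    simp_rw [card_filter]
    exact sum_comm
  have heq : ∀ Y ∈ U \ Q, (P.filter (fun X => X ⊆ Y)).card = D := by
    rw [← sum_eq_sum_iff_of_le hdown]
    apply le_antisymm (sum_le_sum hdown)
    rw [hdc, sum_const, hUQ, ← sum_const]
    exact sum_le_sum hup
  have hfull : ∀ Y ∈ U \ Q, ∀ X, X.card = l → X ⊆ Y → X ∈ P := by
    intro Y hY X hX hXY
    have h1 : P.filter (fun X => X ⊆ Y) = powersetCard l Y := by
      apply eq_of_subset_of_card_le (hsubP Y)
      rw [heq Y hY]
      rw [mem_sdiff, hU, mem_powersetCard] at hY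
      rw [card_powersetCard, hY.1.2]
    have : X ∈ powersetCard l Y := by rw [mem_powersetCard]; exact ⟨hXY, hX⟩
    rw [← h1, mem_filter] at this
    exact this.1
  have hall : ∀ t : ℕ, ∀ X ∈ P, ∀ X' : Finset (Fin n), X'.card = l → (X' \ X).card = t → X' ∈ P := by
    intro t
    induction t with
    | zero =>
      intro X hX X' hX' h
      rw [card_eq_zero, sdiff_eq_empty_iff_subset] at h
      have := eq_of_subset_of_card_le h (by rw [hX', hP X hX])
      rwa [this]
    | succ t ih =>
      intro X hX X' hX' h
      have hXc := hP X hX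
      have h' : (X \ X').card = t + 1 := by
        rw [← h]; exact (card_sdiff_comm (by rw [hXc, hX']))
      obtain ⟨b, hb⟩ : (X' \ X).Nonempty := by rw [← card_pos]; omega
      obtain ⟨a, ha⟩ : (X \ X').Nonempty := by rw [← card_pos]; omega
      rw [mem_sdiff] at ha
      have hb' := mem_sdiff.mp hb
      have hc1 : (insert b X).card = l + 1 := by rw [card_insert_of_notMem hb'.2, hXc]
      obtain ⟨Y, hY1, hY2⟩ := exists_superset_card_eq (s := insert b X) (n := l + m)
        (by omega) (by rw [Fintype.card_fin]; omega)
      have hXY : X ⊆ Y := (subset_insert _ _).trans hY1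
      have hYU : Y ∈ U \ Q := by
        rw [mem_sdiff, hU, mem_powersetCard]
        exact ⟨⟨subset_univ _, hY2⟩, fun h => hfree X hX Y h hXY⟩
      have hX1 : insert b (X.erase a) ∈ P := by
        apply hfull Y hYU
        · rw [card_insert_of_notMem (fun h => hb'.2 (mem_of_mem_erase h)), card_erase_of_mem ha.1, hXc]
          have := card_pos.mpr ⟨a, ha.1⟩
          omega
        · exact (insert_subset_insert _ (erase_subset _ _)).trans hY1
      apply ih _ hX1 X' hX'
      have e : X' \ insert b (X.erase a) = (X' \ X).erase b := by
        ext z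
        simp only [mem_sdiff, mem_insert, mem_erase]
        constructor
        · rintro ⟨h1, h2⟩
          push Not at h2
          refine ⟨h2.1, h1, fun hz => h2.2 ?_ hz⟩
          rintro rfl
          exact ha.2 h1
        · rintro ⟨h1, h2, h3⟩
          exact ⟨h2, by tauto⟩
      rw [e, card_erase_of_mem hb, h]
      rfl
  obtain ⟨X, hX⟩ := hne
  have hPfull : powersetCard l (univ : Finset (Fin n)) ⊆ P := by
    intro X' hX'
    rw [mem_powersetCard] at hX'
    exact hall _ X hX X' hX'.2 rfl
  have := card_le_card hPfull
  rw [card_powersetCard, card_univ, Fintype.card_fin] at this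
  rw [← card_eq_zero]
  omega

theorem Blow_sum {n m : ℕ} (hnm : m ≤ n) (hm : 1 ≤ m) (f : ℕ → ℚ) :
    ∑ X ∈ Blow n m, f X.card =
      ∑ i ∈ range m, ((n.choose ((n - m + 1) / 2 + i) : ℕ) : ℚ) * f ((n - m + 1) / 2 + i) := by
  have hmaps : ∀ X ∈ Blow n m, X.card - (n - m + 1) / 2 ∈ range m := by
    intro X hX
    simp only [Blow, mem_filter, mem_univ, true_and] at hX
    rw [mem_range]; omega
  rw [← sum_fiberwise_of_maps_to hmaps]
  apply sum_congr rfl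
  intro i hi
  rw [mem_range] at hi
  have e : (Blow n m).filter (fun X => X.card - (n - m + 1) / 2 = i) =
      powersetCard ((n - m + 1) / 2 + i) univ := by
    ext X
    simp only [Blow, mem_filter, mem_univ, true_and, mem_powersetCard, subset_univ]
    omega
  rw [e, sum_congr rfl (g := fun _ => f ((n - m + 1) / 2 + i))]
  · rw [sum_const, card_powersetCard, card_univ, Fintype.card_fin, nsmul_eq_mul]
  · intro X hX
    rw [(mem_powersetCard.mp hX).2]

theorem Blow_card {n m : ℕ} (hnm : m ≤ n) (hm : 1 ≤ m) :
    (Blow n m).card = middleBinomSum n m := by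
  have := Blow_sum hnm hm (fun _ => 1)
  simp only [sum_const, nsmul_eq_mul, mul_one] at this
  rw [middleBinomSum]
  exact_mod_cast this

theorem extremal_levels {n m : ℕ} (hnm : m ≤ n) (hm : 2 ≤ m) (F : Finset (Finset (Fin n)))
    (hcard : F.card = middleBinomSum n m)
    (hlub : ∑ X ∈ F, (1:ℚ) / ((n.choose X.card : ℕ) : ℚ) ≤ m) :
    ∀ X : Finset (Fin n), (X ∈ F ∧ X ∉ Blow n m) ∨ (X ∉ F ∧ X ∈ Blow n m) →
      X.card = (n - m + 1) / 2 ∨ X.card = n - (n - m + 1) / 2 := by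
  set l := (n - m + 1) / 2 with hl
  set T : ℚ := ((n.choose l : ℕ) : ℚ) with hT
  have hcn : ∀ X : Finset (Fin n), X.card ≤ n := fun X => by simpa using card_le_univ X
  have hpos : ∀ X : Finset (Fin n), (0:ℚ) < ((n.choose X.card : ℕ) : ℚ) := fun X => by
    exact_mod_cast Nat.choose_pos (hcn X)
  set f : Finset (Fin n) → ℚ := fun X => 1 - T * (1 / ((n.choose X.card : ℕ) : ℚ)) with hf
  have hw : ∑ X ∈ Blow n m, (1:ℚ) / ((n.choose X.card : ℕ) : ℚ) = m := by
    rw [Blow_sum hnm (by omega) (fun c => (1:ℚ) / ((n.choose c : ℕ) : ℚ))]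
    rw [sum_congr rfl (g := fun _ => (1:ℚ))]
    · simp
    · intro i hi
      rw [mem_range] at hi
      have : (0:ℚ) < ((n.choose ((n - m + 1) / 2 + i) : ℕ) : ℚ) := by
        exact_mod_cast Nat.choose_pos (by omega)
      field_simp
  have hB : ∀ X ∈ Blow n m, 0 ≤ f X := by
    intro X hX
    simp only [Blow, mem_filter, mem_univ, true_and] at hX
    have : n.choose l ≤ n.choose X.card := cmono2 _ _ _ (by omega) (by omega)
    have h2 : T ≤ ((n.choose X.card : ℕ) : ℚ) := by rw [hT]; exact_mod_cast this
    simp only [hf, mul_one_div, sub_nonneg]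
    exact (div_le_one (hpos X)).mpr h2
  have hNB : ∀ X ∉ Blow n m, f X ≤ 0 := by
    intro X hX
    simp only [Blow, mem_filter, mem_univ, true_and] at hX
    have hXn := hcn X
    have : n.choose X.card ≤ n.choose l := by
      by_cases h : X.card ≤ l
      · exact cmono2 _ _ _ h (by omega)
      · rw [← Nat.choose_symm hXn]
        exact cmono2 _ _ _ (by omega) (by omega)
    have h2 : ((n.choose X.card : ℕ) : ℚ) ≤ T := by rw [hT]; exact_mod_cast this
    simp only [hf, mul_one_div, sub_nonpos]
    exact (one_le_div (hpos X)).mpr h2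
  have hsumF : ∑ X ∈ Blow n m, f X ≤ ∑ X ∈ F, f X := by
    simp only [hf, sum_sub_distrib, ← mul_sum, hw, sum_const, nsmul_eq_mul, mul_one]
    rw [hcard, Blow_card hnm (by omega)]
    have : 0 ≤ T := by positivity
    nlinarith
  have e1 := sum_inter_add_sum_sdiff F (Blow n m) f
  have e2 := sum_inter_add_sum_sdiff (Blow n m) F f
  rw [inter_comm] at e2
  have z1 : ∑ X ∈ F \ Blow n m, f X ≤ 0 :=
    sum_nonpos fun X hX => hNB X (mem_sdiff.mp hX).2
  have z2 : 0 ≤ ∑ X ∈ Blow n m \ F, f X :=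
    sum_nonneg fun X hX => hB X (mem_sdiff.mp hX).1
  have y1 : ∑ X ∈ F \ Blow n m, f X = 0 := by linarith
  have y2 : ∑ X ∈ Blow n m \ F, f X = 0 := by linarith
  rw [sum_eq_zero_iff_of_nonpos (fun X hX => hNB X (mem_sdiff.mp hX).2)] at y1
  rw [sum_eq_zero_iff_of_nonneg (fun X hX => hB X (mem_sdiff.mp hX).1)] at y2
  intro X hX
  have hfX : f X = 0 := by
    rcases hX with h | h
    · exact y1 X (mem_sdiff.mpr h)
    · exact y2 X (mem_sdiff.mpr h.symm)
  have hTX : n.choose l = n.choose X.card := by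
    simp only [hf, mul_one_div, sub_eq_zero] at hfX
    have := (eq_div_iff (hpos X).ne').mp hfX
    rw [one_mul, hT] at this
    exact_mod_cast this.symm
  have hXn := hcn X
  by_contra hc
  push Not at hc
  rcases lt_or_gt_of_ne hc.1 with h | h
  · have := cmono2_strict n X.card l h (by omega)
    omega
  · rcases lt_or_gt_of_ne hc.2 with h' | h'
    · have := cmono2_strict n l X.card h (by omega)
      omega
    · have := cmono2_strict n (n - X.card) l (by omega) (by omega)
      rw [Nat.choose_symm hXn] at this
      omega

/-- For `k ≥ 2`, `m = ⌈log₂(k+2)⌉`, and `2^{m-1} - 1 ≤ k ≤ 2^m - C(m,⌊m/2⌋) - 1`,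
a `D_k`-free family of subsets of `[n]` of size `Σ(n,m)` must be `B(n,m)`. -/
theorem extremal_dkFree_case1 (k : ℕ) (hk : 2 ≤ k) (m : ℕ)
    (hm : m = Nat.clog 2 (k + 2))
    (hk1 : 2 ^ (m - 1) - 1 ≤ k) (hk2 : k ≤ 2 ^ m - m.choose (m / 2) - 1)
    (n : ℕ) (hn : 1 ≤ n)
    (F : Finset (Finset (Fin n))) (hF : DkFree n k F)
    (hcard : F.card = middleBinomSum n m) :
    F = Blow n m ∨ F = Bhigh n m := by
  classical
  have hm2 : 2 ≤ m := by
    by_contra h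
    have : m = 0 ∨ m = 1 := by omega
    rcases this with h | h <;> rw [h] at hk2 <;> norm_num at hk2 <;> omega
  have hk' : k + 1 ≤ 2 ^ m - m.choose (m / 2) := by omega
  have hcn : ∀ X : Finset (Fin n), X.card ≤ n := fun X => by simpa using card_le_univ X
  rcases lt_or_ge n m with hnm | hnm
  · left
    have h1 : F.card = 2 ^ n := by
      rw [hcard, middleBinomSum, ← Nat.sum_range_choose n]
      have : (n - m + 1) / 2 = 0 := by omega
      simp only [this, zero_add]
      symm
      apply sum_subset
      · intro i; simp only [mem_range]; omega
      · intro i _ hi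
        rw [mem_range] at hi
        exact Nat.choose_eq_zero_of_lt (by omega)
    have h2 : F = univ := by
      rw [← card_eq_iff_eq_univ, h1]; simp
    rw [h2]
    ext X
    have := hcn X
    simp only [Blow, mem_filter, mem_univ, true_and, true_iff]
    omega
  have hlub := lubell_le F m (by positivity)
    (fun A hA B hB hAB => interval_bound F hF (by omega) hk' A B hA hB hAB)
  have hlev := extremal_levels hnm hm2 F hcard hlub
  have hBc := Blow_card hnm (show 1 ≤ m by omega)
  have hsubB : F ⊆ Blow n m → F = Blow n m := fun h =>
    eq_of_subset_of_card_le h (by rw [hBc, hcard])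
  by_cases hpar : (n - m) % 2 = 1
  · left
    apply hsubB
    intro X hX
    by_contra hc
    have := hlev X (Or.inl ⟨hX, hc⟩)
    apply hc
    simp only [Blow, mem_filter, mem_univ, true_and]
    omega
  obtain ⟨l, hl⟩ : ∃ l, n = l + m + l := ⟨(n - m) / 2, by omega⟩
  have hl0 : (n - m + 1) / 2 = l := by omega
  have hnl : n - l = l + m := by omega
  rw [hl0, hnl] at hlev
  have hBm : ∀ X, X ∈ Blow n m ↔ l ≤ X.card ∧ X.card < l + m := by
    intro X
    simp only [Blow, mem_filter, mem_univ, true_and]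
    omega
  have hrange : ∀ X ∈ F, l ≤ X.card ∧ X.card ≤ l + m := by
    intro X hX
    by_cases h : X ∈ Blow n m
    · have := (hBm X).mp h; omega
    · have := hlev X (Or.inl ⟨hX, h⟩); omega
  have hmid : ∀ X : Finset (Fin n), l < X.card → X.card < l + m → X ∈ F := by
    intro X h1 h2
    by_contra h
    have := hlev X (Or.inr ⟨h, (hBm X).mpr ⟨by omega, h2⟩⟩)
    omega
  set P := F.filter (fun X => X.card = l) with hP
  set Q := F.filter (fun X => X.card = l + m) with hQ
  set Mid := (univ : Finset (Finset (Fin n))).filter (fun X => l < X.card ∧ X.card < l + m) with hMid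
  have c1 : F.card = P.card + Q.card + Mid.card := by
    rw [← card_union_of_disjoint, ← card_union_of_disjoint]
    · congr 1
      ext X
      simp only [hP, hQ, hMid, mem_union, mem_filter, mem_univ, true_and]
      constructor
      · intro h
        have := hrange X h
        have : X.card = l ∨ X.card = l + m ∨ (l < X.card ∧ X.card < l + m) := by omega
        tauto
      · rintro ((h | h) | h)
        · exact h.1
        · exact h.1
        · exact hmid X h.1 h.2
    · rw [disjoint_left]
      intro X
      simp only [hP, hQ, hMid, mem_union, mem_filter, mem_univ, true_and]
      rintro (h | h) <;> omega
    · rw [disjoint_left]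
      intro X
      simp only [hP, hQ, mem_filter]
      rintro h; omega
  have c2 : (Blow n m).card = n.choose l + Mid.card := by
    have : n.choose l = (powersetCard l (univ : Finset (Fin n))).card := by simp
    rw [this, ← card_union_of_disjoint]
    · congr 1
      ext X
      rw [hBm]
      simp only [hMid, mem_union, mem_filter, mem_univ, true_and, mem_powersetCard, subset_univ]
      omega
    · rw [disjoint_left]
      intro X
      simp only [hMid, mem_filter, mem_univ, true_and, mem_powersetCard, subset_univ]
      omega
  have hPQ : P.card + Q.card = n.choose l := by omega
  have hfree : ∀ X ∈ P, ∀ Y ∈ Q, ¬ X ⊆ Y := by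
    intro X hX Y hY hXY
    rw [hP, mem_filter] at hX
    rw [hQ, mem_filter] at hY
    have hne : X ≠ Y := by rintro rfl; omega
    have h1 := interval_card F hF X Y hX.1 hY.1 hne
    have h2 : Finset.Icc X Y ⊆ F.filter (fun Z => X ⊆ Z ∧ Z ⊆ Y) := by
      intro Z hZ
      rw [Finset.mem_Icc] at hZ
      have hZ' : X ⊆ Z ∧ Z ⊆ Y := hZ
      rw [mem_filter]
      refine ⟨?_, hZ'⟩
      rcases hZ'.1.eq_or_ssubset with h | h
      · rw [← h]; exact hX.1
      rcases hZ'.2.eq_or_ssubset with h' | h'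
      · rw [h']; exact hY.1
      have := card_lt_card h
      have := card_lt_card h'
      exact hmid Z (by omega) (by omega)
    have h3 := card_le_card h2
    rw [Finset.card_Icc_finset hXY, hX.2, hY.2, Nat.add_sub_cancel_left] at h3
    have := Nat.choose_pos (show m / 2 ≤ m by omega)
    have : 0 < 2 ^ m := by positivity
    omega
  rcases P.eq_empty_or_nonempty with hPe | hPne
  · right
    have hQc : Q = powersetCard (l + m) (univ : Finset (Fin n)) := by
      apply eq_of_subset_of_card_le
      · intro X hX
        rw [hQ, mem_filter] at hX
        rw [mem_powersetCard]
        exact ⟨subset_univ _, hX.2⟩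
      · rw [card_powersetCard, card_univ, Fintype.card_fin, ← hnl, Nat.choose_symm (by omega), ← hPQ, hPe]
        simp
    ext X
    have hb : X ∈ Bhigh n m ↔ l < X.card ∧ X.card ≤ l + m := by
      simp only [Bhigh, mem_filter, mem_univ, true_and]
      omega
    rw [hb]
    constructor
    · intro h
      have h1 := hrange X h
      have h2 : X.card ≠ l := by
        intro h2
        have : X ∈ P := by rw [hP, mem_filter]; exact ⟨h, h2⟩
        rw [hPe] at this
        simp at this
      omega
    · rintro ⟨h1, h2⟩
      rcases h2.eq_or_lt with h | h
      · have : X ∈ Q := by rw [hQc, mem_powersetCard]; exact ⟨subset_univ _, h⟩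
        rw [hQ, mem_filter] at this
        exact this.1
      · exact hmid X h1 h
  · left
    have hQe := two_level hl (by omega) P Q (fun X hX => (mem_filter.mp hX).2)
      (fun X hX => (mem_filter.mp hX).2) hPQ hfree hPne
    apply hsubB
    intro X hX
    rw [hBm]
    have h1 := hrange X hX
    have h2 : X.card ≠ l + m := by
      intro h2
      have : X ∈ Q := by rw [hQ, mem_filter]; exact ⟨hX, h2⟩
      rw [hQe] at this
      simp at this
    omega
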